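/- arXiv:1303.2967 — 2 statements merged into one kernel-verified Lean document; each statement's English description precedes it below -/
import Mathlib

section
/- Let E be a set of n×n orthogonal matrices all of whose entries are rational numbers, and let G = Cl(⟨E⟩) be the topological closure of the subgroup generated by E. Then G equals the set of all n×n real matrices M such that p(M) = 0 for every polynomial p in the n² matrix entries with RATIONAL coefficients satisfying p(I) = 0 and the identity p(eX) = p(X) for all e ∈ E. -/
/-- Evaluation of a polynomial with rational coefficients in the `n²` matrix entries at a real
matrix, via the algebra map `ℚ → ℝ`. -/
noncomputable def matEvalQ {ι : Type} [Fintype ι] (M : Matrix ι ι ℝ)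
    (p : MvPolynomial (ι × ι) ℚ) : ℝ :=
  MvPolynomial.aeval (fun ij => M ij.1 ij.2) p

open MeasureTheory

section RationalComponents

variable {σ : Type} [Fintype σ]

/-- Apply a `ℚ`-linear functional on `ℝ` to the coefficients of a real polynomial. -/
noncomputable def rationalComponent (l : ℝ →ₗ[ℚ] ℚ) (q : MvPolynomial σ ℝ) : MvPolynomial σ ℚ :=
  ∑ d ∈ q.support, MvPolynomial.monomial d (l (q.coeff d))

theorem aeval_rationalComponent (l : ℝ →ₗ[ℚ] ℚ) (q : MvPolynomial σ ℝ) (x : σ → ℝ) :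
    MvPolynomial.aeval x (rationalComponent l q)
      = ∑ d ∈ q.support, (l (q.coeff d) : ℝ) * ∏ i, x i ^ d i := by
  simp [rationalComponent, MvPolynomial.aeval_monomial, Finsupp.prod_fintype]

theorem aeval_ratCast_rationalComponent (l : ℝ →ₗ[ℚ] ℚ) (q : MvPolynomial σ ℝ) (x : σ → ℚ) :
    MvPolynomial.aeval (fun i => (x i : ℝ)) (rationalComponent l q)
      = (l (MvPolynomial.eval (fun i => (x i : ℝ)) q) : ℝ) := by
  rw [aeval_rationalComponent, MvPolynomial.eval_eq', map_sum, Rat.cast_sum]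
  refine Finset.sum_congr rfl fun d _ => ?_
  have h : q.coeff d * ∏ i, (x i : ℝ) ^ d i = (∏ i, x i ^ d i) • q.coeff d := by
    rw [Rat.smul_def]
    push_cast
    ring
  rw [h, map_smul, smul_eq_mul]
  push_cast
  ring

theorem eval_eq_of_forall_aeval_rationalComponent_eq (q : MvPolynomial σ ℝ) {x y : σ → ℝ}
    (h : ∀ l : ℝ →ₗ[ℚ] ℚ, MvPolynomial.aeval x (rationalComponent l q)
      = MvPolynomial.aeval y (rationalComponent l q)) :
    MvPolynomial.eval x q = MvPolynomial.eval y q := by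
  classical
  let b := Module.Basis.ofVectorSpace ℚ ℝ
  let B := q.support.biUnion fun d => (b.repr (q.coeff d)).support
  have key (z : σ → ℝ) : MvPolynomial.eval z q
      = ∑ i ∈ B, b i * MvPolynomial.aeval z (rationalComponent (b.coord i) q) := by
    simp_rw [aeval_rationalComponent, Finset.mul_sum]
    rw [Finset.sum_comm, MvPolynomial.eval_eq']
    refine Finset.sum_congr rfl fun d hd => ?_
    have hsum : ∑ i ∈ B, (b.repr (q.coeff d) i) • b i = q.coeff d := by
      conv_rhs => rw [← b.linearCombination_repr (q.coeff d), Finsupp.linearCombination_apply]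
      exact (Finsupp.sum_of_support_subset _
        (Finset.subset_biUnion_of_mem (fun d => (b.repr (q.coeff d)).support) hd)
        (fun i a => a • b i) (by simp)).symm
    conv_lhs => rw [← hsum, Finset.sum_mul]
    refine Finset.sum_congr rfl fun i _ => ?_
    rw [Rat.smul_def, Module.Basis.coord_apply]
    ring
  rw [key, key]
  exact Finset.sum_congr rfl fun i _ => by rw [h]

end RationalComponents

section Matrices

variable {ι : Type}

/-- Evaluation of a real polynomial in the matrix entries at a real matrix. -/
noncomputable def matEvalR (M : Matrix ι ι ℝ) (p : MvPolynomial (ι × ι) ℝ) : ℝ :=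
  MvPolynomial.eval (fun ij => M ij.1 ij.2) p

theorem continuous_matEvalR (p : MvPolynomial (ι × ι) ℝ) :
    Continuous fun M : Matrix ι ι ℝ => matEvalR M p :=
  (MvPolynomial.continuous_eval p).comp (by fun_prop)

theorem denseRange_matrix_ratCast :
    DenseRange fun X : Matrix ι ι ℚ => (X.map (Rat.cast : ℚ → ℝ)) :=
  DenseRange.piMap fun _ => DenseRange.piMap fun _ => Rat.denseRange_cast

variable [Fintype ι]

theorem continuous_matEvalQ (p : MvPolynomial (ι × ι) ℚ) :
    Continuous fun M : Matrix ι ι ℝ => matEvalQ M p := by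
  simp only [matEvalQ, MvPolynomial.aeval_def, ← MvPolynomial.eval_map]
  exact (MvPolynomial.continuous_eval _).comp (by fun_prop)

theorem matEvalQ_map_ratCast_rationalComponent (l : ℝ →ₗ[ℚ] ℚ) (q : MvPolynomial (ι × ι) ℝ)
    (Y : Matrix ι ι ℚ) :
    matEvalQ (Y.map (Rat.cast : ℚ → ℝ)) (rationalComponent l q)
      = (l (matEvalR (Y.map (Rat.cast : ℚ → ℝ)) q) : ℝ) :=
  aeval_ratCast_rationalComponent l q fun ij => Y ij.1 ij.2

theorem matEvalQ_rationalComponent_mul {e : Matrix ι ι ℝ} (he : ∀ i j, ∃ r : ℚ, e i j = r)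
    {q : MvPolynomial (ι × ι) ℝ} (hq : ∀ X, matEvalR (e * X) q = matEvalR X q)
    (l : ℝ →ₗ[ℚ] ℚ) (X : Matrix ι ι ℝ) :
    matEvalQ (e * X) (rationalComponent l q) = matEvalQ X (rationalComponent l q) := by
  choose r hr using he
  refine congrFun (denseRange_matrix_ratCast.equalizer
    ((continuous_matEvalQ _).comp (continuous_const.matrix_mul continuous_id))
    (continuous_matEvalQ _) (funext fun Y => ?_)) X
  have hmul : e * Y.map (Rat.cast : ℚ → ℝ) = (Matrix.of r * Y).map (Rat.cast : ℚ → ℝ) := by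
    ext i j
    simp [Matrix.mul_apply, hr]
  simp only [Function.comp_apply, id]
  rw [hmul, matEvalQ_map_ratCast_rationalComponent, matEvalQ_map_ratCast_rationalComponent,
    ← hmul, hq]

theorem exists_matEvalR_mul_eq_sum (p : MvPolynomial (ι × ι) ℝ) :
    ∃ (s : Finset (ι × ι →₀ ℕ)) (c : (ι × ι →₀ ℕ) → MvPolynomial (ι × ι) ℝ),
      ∀ A X : Matrix ι ι ℝ,
        matEvalR (A * X) p = ∑ d ∈ s, matEvalR A (c d) * ∏ ij, X ij.1 ij.2 ^ d ij := by
  let P : MvPolynomial (ι × ι) (MvPolynomial (ι × ι) ℝ) :=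
    MvPolynomial.aeval (fun ij => ∑ k, MvPolynomial.C (MvPolynomial.X (ij.1, k)) *
      MvPolynomial.X (k, ij.2)) p
  refine ⟨P.support, P.coeff, fun A X => ?_⟩
  have h := MvPolynomial.eval₂_eq' (MvPolynomial.eval fun ij : ι × ι => A ij.1 ij.2)
    (fun ij : ι × ι => X ij.1 ij.2) P
  rw [matEvalR]
  refine Eq.trans ?_ h
  rw [← MvPolynomial.coe_eval₂Hom, MvPolynomial.map_aeval]
  have h1 : (MvPolynomial.eval₂Hom (MvPolynomial.eval fun ij : ι × ι => A ij.1 ij.2)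
      (fun ij : ι × ι => X ij.1 ij.2)).comp
      (algebraMap ℝ (MvPolynomial (ι × ι) (MvPolynomial (ι × ι) ℝ))) = RingHom.id ℝ := by
    ext r
    simp
  rw [h1]
  refine congrArg (fun f => MvPolynomial.eval₂Hom (RingHom.id ℝ) f p) (funext fun ij => ?_)
  simp [Matrix.mul_apply]

theorem exists_matEvalR_eq_integral {Γ : Type*} [TopologicalSpace Γ] [CompactSpace Γ]
    [MeasurableSpace Γ] [BorelSpace Γ] (μ : Measure Γ) [IsFiniteMeasure μ]
    {ρ : Γ → Matrix ι ι ℝ} (hρ : Continuous ρ) (p : MvPolynomial (ι × ι) ℝ) :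
    ∃ q : MvPolynomial (ι × ι) ℝ, ∀ X, matEvalR X q = ∫ g, matEvalR (ρ g * X) p ∂μ := by
  obtain ⟨s, c, h⟩ := exists_matEvalR_mul_eq_sum p
  refine ⟨∑ d ∈ s, MvPolynomial.monomial d (∫ g, matEvalR (ρ g) (c d) ∂μ), fun X => ?_⟩
  simp_rw [h]
  rw [integral_finsetSum]
  · simp_rw [integral_mul_const]
    simp [matEvalR, MvPolynomial.eval_monomial, Finsupp.prod_fintype]
  · intro d _
    have hc : Continuous fun g => matEvalR (ρ g) (c d) := (continuous_matEvalR _).comp hρ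
    exact (hc.integrable_of_hasCompactSupport (HasCompactSupport.of_compactSpace _)).mul_const _

variable [DecidableEq ι]

theorem isClosed_orthogonalGroup :
    IsClosed (Matrix.orthogonalGroup ι ℝ : Set (Matrix ι ι ℝ)) := by
  have : (Matrix.orthogonalGroup ι ℝ : Set (Matrix ι ι ℝ)) = {A | A * A.transpose = 1} := by
    ext A
    exact Matrix.mem_orthogonalGroup_iff _ _
  rw [this]
  exact isClosed_eq (by fun_prop) continuous_const

instance compactSpace_orthogonalGroup : CompactSpace (Matrix.orthogonalGroup ι ℝ) := by
  have h : IsCompact (Set.univ.pi fun _ : ι => Set.univ.pi fun _ : ι => Set.Icc (-1 : ℝ) 1) :=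
    isCompact_univ_pi fun _ => isCompact_univ_pi fun _ => isCompact_Icc
  refine isCompact_iff_compactSpace.mp (h.of_isClosed_subset isClosed_orthogonalGroup ?_)
  intro A hA i _ j _
  exact abs_le.mp (entry_norm_bound_of_unitary hA i j)

theorem exists_matEvalR_near (f : C(Matrix.orthogonalGroup ι ℝ, ℝ)) {ε : ℝ} (hε : 0 < ε) :
    ∃ p : MvPolynomial (ι × ι) ℝ, ∀ A : Matrix.orthogonalGroup ι ℝ,
      |matEvalR (A : Matrix ι ι ℝ) p - f A| < ε := by
  let entry (ij : ι × ι) : C(Matrix.orthogonalGroup ι ℝ, ℝ) :=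
    ⟨fun A => (A : Matrix ι ι ℝ) ij.1 ij.2, continuous_subtype_val.matrix_elem ij.1 ij.2⟩
  let φ : MvPolynomial (ι × ι) ℝ →ₐ[ℝ] C(Matrix.orthogonalGroup ι ℝ, ℝ) :=
    MvPolynomial.aeval entry
  have hφ (p : MvPolynomial (ι × ι) ℝ) (A : Matrix.orthogonalGroup ι ℝ) :
      φ p A = matEvalR (A : Matrix ι ι ℝ) p := by
    have h := MvPolynomial.map_aeval entry
      (ContinuousMap.evalAlgHom ℝ ℝ A : C(Matrix.orthogonalGroup ι ℝ, ℝ) →+* ℝ) p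
    refine h.trans ?_
    have h1 : (ContinuousMap.evalAlgHom ℝ ℝ A : C(Matrix.orthogonalGroup ι ℝ, ℝ) →+* ℝ).comp
        (algebraMap ℝ C(Matrix.orthogonalGroup ι ℝ, ℝ)) = RingHom.id ℝ := by
      ext r
      rfl
    rw [h1]
    rfl
  have hsep : φ.range.SeparatesPoints := by
    intro A B hAB
    by_contra! hcon
    refine hAB (Subtype.ext (Matrix.ext fun i j => ?_))
    have := hcon _ ⟨φ (MvPolynomial.X (i, j)), ⟨_, rfl⟩, rfl⟩
    simpa [hφ, matEvalR] using this
  obtain ⟨⟨_, p, rfl⟩, hp⟩ :=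
    ContinuousMap.exists_mem_subalgebra_near_continuousMap_of_separatesPoints _ hsep f ε hε
  refine ⟨p, fun A => ?_⟩
  have := (ContinuousMap.norm_lt_iff _ hε).mp hp A
  rw [← hφ]
  exact this

theorem exists_invariant_matEvalR_ne (G : Subgroup (Matrix.orthogonalGroup ι ℝ))
    (hG : IsClosed (G : Set (Matrix.orthogonalGroup ι ℝ))) {M : Matrix.orthogonalGroup ι ℝ}
    (hM : M ∉ G) :
    ∃ q : MvPolynomial (ι × ι) ℝ,
      (∀ e ∈ G, ∀ X : Matrix ι ι ℝ, matEvalR ((e : Matrix ι ι ℝ) * X) q = matEvalR X q) ∧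
      matEvalR (1 : Matrix ι ι ℝ) q ≠ matEvalR (M : Matrix ι ι ℝ) q := by
  have hclosed : IsClosed ((fun A => A * M⁻¹) ⁻¹' (G : Set (Matrix.orthogonalGroup ι ℝ))) :=
    hG.preimage (by fun_prop)
  have hdisj : Disjoint (G : Set (Matrix.orthogonalGroup ι ℝ))
      ((fun A => A * M⁻¹) ⁻¹' (G : Set (Matrix.orthogonalGroup ι ℝ))) := by
    rw [Set.disjoint_left]
    intro A hA hA'
    exact hM (by simpa using (G.mul_mem_cancel_left hA).mp hA')
  obtain ⟨f, hf0, hf1, -⟩ := exists_continuous_zero_one_of_isClosed hG hclosed hdisj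
  obtain ⟨p, hp⟩ := exists_matEvalR_near f (ε := 1 / 3) (by norm_num)
  have : CompactSpace G := isCompact_iff_compactSpace.mp hG.isCompact
  let _ : MeasurableSpace G := borel G
  have : BorelSpace G := ⟨rfl⟩
  let μ : Measure G := Measure.haarMeasure ⊤
  have : IsProbabilityMeasure μ := ⟨Measure.haarMeasure_self (K₀ := ⊤)⟩
  let ρ : G → Matrix ι ι ℝ := fun g => ((g⁻¹ : G) : Matrix.orthogonalGroup ι ℝ)
  have hρ : Continuous ρ :=
    continuous_subtype_val.comp (continuous_subtype_val.comp continuous_inv)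
  obtain ⟨q, hq⟩ := exists_matEvalR_eq_integral μ hρ p
  have hint (X : Matrix ι ι ℝ) : Integrable (fun g => matEvalR (ρ g * X) p) μ := by
    have hc : Continuous fun g => matEvalR (ρ g * X) p :=
      (continuous_matEvalR p).comp (hρ.matrix_mul continuous_const)
    exact hc.integrable_of_hasCompactSupport (HasCompactSupport.of_compactSpace _)
  refine ⟨q, fun e he X => ?_, ?_⟩
  · rw [hq, hq, ← integral_mul_left_eq_self (fun g => matEvalR (ρ g * X) p) (⟨e, he⟩⁻¹ : G)]
    refine integral_congr_ae (Filter.Eventually.of_forall fun g => ?_)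
    simp [ρ, Matrix.mul_assoc]
  · have h0 : matEvalR (1 : Matrix ι ι ℝ) q ≤ 1 / 3 := by
      rw [hq]
      have := integral_mono (hint 1) (integrable_const (1 / 3 : ℝ)) (fun g => ?_)
      · simpa using this
      · have h1 := hp ((g⁻¹ : G) : Matrix.orthogonalGroup ι ℝ)
        rw [hf0 (g⁻¹).2, abs_lt] at h1
        simp only [Pi.zero_apply, sub_zero] at h1
        simpa [ρ] using h1.2.le
    have h1 : 2 / 3 ≤ matEvalR (M : Matrix ι ι ℝ) q := by
      rw [hq]
      have := integral_mono (integrable_const (2 / 3 : ℝ)) (hint M) (fun g => ?_)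
      · simpa using this
      · have h1 := hp (((g⁻¹ : G) : Matrix.orthogonalGroup ι ℝ) * M)
        rw [hf1 (by simp), abs_lt] at h1
        simp only [Pi.one_apply] at h1
        have h2 : 2 / 3 ≤ matEvalR ((((g⁻¹ : G) : Matrix.orthogonalGroup ι ℝ) * M :
          Matrix.orthogonalGroup ι ℝ) : Matrix ι ι ℝ) p := by linarith [h1.1]
        simpa [ρ] using h2
    intro h
    linarith

theorem matEvalQ_mul_eq_of_mem_closure {E : Set (Matrix.orthogonalGroup ι ℝ)}
    {p : MvPolynomial (ι × ι) ℚ}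
    (hp : ∀ e ∈ E, ∀ X : Matrix ι ι ℝ, matEvalQ ((e : Matrix ι ι ℝ) * X) p = matEvalQ X p)
    {g : Matrix.orthogonalGroup ι ℝ} (hg : g ∈ Subgroup.closure E) (X : Matrix ι ι ℝ) :
    matEvalQ ((g : Matrix ι ι ℝ) * X) p = matEvalQ X p := by
  induction hg using Subgroup.closure_induction generalizing X with
  | mem e he => exact hp e he X
  | one => simp
  | mul a b _ _ ha hb =>
    rw [Submonoid.coe_mul, Matrix.mul_assoc, ha, hb]
  | inv a _ ha =>
    rw [← ha, ← Matrix.mul_assoc, ← Submonoid.coe_mul, mul_inv_cancel, Submonoid.coe_one,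
      Matrix.one_mul]

theorem mem_orthogonalGroup_of_forall_matEvalQ_eq_zero {E : Set (Matrix.orthogonalGroup ι ℝ)}
    {M : Matrix ι ι ℝ}
    (hM : ∀ p : MvPolynomial (ι × ι) ℚ, matEvalQ (1 : Matrix ι ι ℝ) p = 0 →
      (∀ e ∈ E, ∀ X : Matrix ι ι ℝ, matEvalQ ((e : Matrix ι ι ℝ) * X) p = matEvalQ X p) →
      matEvalQ M p = 0) :
    M ∈ Matrix.orthogonalGroup ι ℝ := by
  rw [Matrix.mem_orthogonalGroup_iff' _ _]
  ext i j
  let p : MvPolynomial (ι × ι) ℚ :=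
    ∑ k, MvPolynomial.X (k, i) * MvPolynomial.X (k, j)
      - MvPolynomial.C ((1 : Matrix ι ι ℚ) i j)
  have hp (X : Matrix ι ι ℝ) :
      matEvalQ X p = (X.transpose * X) i j - (1 : Matrix ι ι ℝ) i j := by
    simp [p, matEvalQ, Matrix.mul_apply, Matrix.one_apply]
  have := hM p (by simp [hp]) fun e _ X => by
    have he : (e : Matrix ι ι ℝ).transpose * (e : Matrix ι ι ℝ) = 1 :=
      (Matrix.mem_orthogonalGroup_iff' _ _).mp e.2
    rw [hp, hp, Matrix.transpose_mul, Matrix.mul_assoc, ← Matrix.mul_assoc _ (e : Matrix ι ι ℝ) X,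
      he, Matrix.one_mul]
  rw [hp] at this
  exact sub_eq_zero.mp this

end Matrices

/-- If `E` is a set of orthogonal matrices with rational entries, then the closure
of the subgroup generated by `E` equals the common zero set of all polynomials `p` with
RATIONAL coefficients in the matrix entries satisfying `p(I) = 0` and `p(eX) = p(X)` for all
`e ∈ E` and all matrices `X`. -/
theorem closure_subgroup_eq_rational_zero_set {n : ℕ}
    (E : Set (Matrix.orthogonalGroup (Fin n) ℝ))
    (hrat : ∀ e ∈ E, ∀ i j, ∃ q : ℚ, (e : Matrix (Fin n) (Fin n) ℝ) i j = (q : ℝ)) :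
    closure (Subtype.val '' (Subgroup.closure E : Set (Matrix.orthogonalGroup (Fin n) ℝ)))
      = {M : Matrix (Fin n) (Fin n) ℝ |
          ∀ p : MvPolynomial (Fin n × Fin n) ℚ,
            matEvalQ (1 : Matrix (Fin n) (Fin n) ℝ) p = 0 →
            (∀ e ∈ E, ∀ X : Matrix (Fin n) (Fin n) ℝ,
              matEvalQ ((e : Matrix (Fin n) (Fin n) ℝ) * X) p = matEvalQ X p) →
            matEvalQ M p = 0} := by
  apply Set.Subset.antisymm
  · have hsub : {M : Matrix (Fin n) (Fin n) ℝ | ∀ p : MvPolynomial (Fin n × Fin n) ℚ,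
            matEvalQ (1 : Matrix (Fin n) (Fin n) ℝ) p = 0 →
            (∀ e ∈ E, ∀ X : Matrix (Fin n) (Fin n) ℝ,
              matEvalQ ((e : Matrix (Fin n) (Fin n) ℝ) * X) p = matEvalQ X p) →
            matEvalQ M p = 0} =
        ⋂ (p : MvPolynomial (Fin n × Fin n) ℚ)
          (_ : matEvalQ (1 : Matrix (Fin n) (Fin n) ℝ) p = 0)
          (_ : ∀ e ∈ E, ∀ X : Matrix (Fin n) (Fin n) ℝ,
              matEvalQ ((e : Matrix (Fin n) (Fin n) ℝ) * X) p = matEvalQ X p),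
          {M | matEvalQ M p = 0} := by
      ext M
      simp
    refine closure_minimal ?_ ?_
    · rintro _ ⟨g, hg, rfl⟩ p hp1 hp
      have := matEvalQ_mul_eq_of_mem_closure hp hg 1
      rwa [Matrix.mul_one, hp1] at this
    · rw [hsub]
      exact isClosed_iInter fun p => isClosed_iInter fun _ => isClosed_iInter fun _ =>
        isClosed_eq (continuous_matEvalQ p) continuous_const
  · intro M hM
    lift M to Matrix.orthogonalGroup (Fin n) ℝ using
      mem_orthogonalGroup_of_forall_matEvalQ_eq_zero hM
    refine image_closure_subset_closure_image continuous_subtype_val ⟨M, ?_, rfl⟩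
    rw [← Subgroup.topologicalClosure_coe]
    by_contra hMG
    obtain ⟨q, hq, hne⟩ := exists_invariant_matEvalR_ne (Subgroup.closure E).topologicalClosure
      (Subgroup.isClosed_topologicalClosure _) hMG
    refine hne (eval_eq_of_forall_aeval_rationalComponent_eq q fun l => ?_)
    let r := rationalComponent l q
    obtain ⟨t, ht⟩ : ∃ t : ℚ, matEvalQ (1 : Matrix (Fin n) (Fin n) ℝ) r = t := by
      have h := matEvalQ_map_ratCast_rationalComponent l q (1 : Matrix (Fin n) (Fin n) ℚ)
      rw [Matrix.map_one _ Rat.cast_zero Rat.cast_one] at h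
      exact ⟨_, h⟩
    have hsub (X : Matrix (Fin n) (Fin n) ℝ) :
        matEvalQ X (r - MvPolynomial.C t) = matEvalQ X r - t := by
      simp [matEvalQ]
    have h := hM (r - MvPolynomial.C t) (by rw [hsub, ht, sub_self]) fun e he X => by
      rw [hsub, hsub, matEvalQ_rationalComponent_mul (hrat e he) (hq e
        (Subgroup.le_topologicalClosure _ (Subgroup.subset_closure he)))]
    rw [hsub, ← ht, sub_eq_zero] at h
    exact h.symm
end

section
/- Let Σ be a finite alphabet, let φ : Σ* → O(n) be a monoid morphism from the free monoid on Σ into the group of n×n real orthogonal matrices, and let L ⊆ Σ* be any language. Then the topological closure of the submonoid of O(n) generated by φ(L) is an algebraic set: there exists a set P of real polynomials in the n² matrix entries whose common zero set (inside the space of n×n real matrices) equals Cl(φ(L)*). -/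
open Matrix

/-- Evaluation of a real polynomial in the `n²` matrix entries at a matrix. -/
noncomputable def matEval {ι : Type} [Fintype ι] (M : Matrix ι ι ℝ)
    (p : MvPolynomial (ι × ι) ℝ) : ℝ :=
  MvPolynomial.eval (fun ij => M ij.1 ij.2) p

open MeasureTheory

section OrthogonalGroup

variable {ι : Type} [Fintype ι]

lemma continuous_matEval (p : MvPolynomial (ι × ι) ℝ) :
    Continuous fun M : Matrix ι ι ℝ => matEval M p := by
  unfold matEval
  exact (MvPolynomial.continuous_eval p).comp (by fun_prop)

/-- The average of a polynomial over right multiplication by a continuous family of matrices is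
again a polynomial. -/
lemma exists_matEval_eq_integral {T : Type*} [TopologicalSpace T] [CompactSpace T]
    [MeasurableSpace T] [BorelSpace T] (μ : Measure T) [IsFiniteMeasure μ]
    (ρ : T → Matrix ι ι ℝ) (hρ : Continuous ρ) (p : MvPolynomial (ι × ι) ℝ) :
    ∃ q : MvPolynomial (ι × ι) ℝ, ∀ X : Matrix ι ι ℝ,
      matEval X q = ∫ t, matEval (X * ρ t) p ∂μ := by
  classical
  let Q : MvPolynomial (ι × ι) C(T, ℝ) := MvPolynomial.eval₂
    (MvPolynomial.C.comp (algebraMap ℝ C(T, ℝ)))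
    (fun ij => ∑ l, MvPolynomial.X (ij.1, l) *
      MvPolynomial.C (⟨fun t => ρ t l ij.2, hρ.matrix_elem l ij.2⟩ : C(T, ℝ))) p
  let evalAt (t : T) : C(T, ℝ) →+* ℝ := (ContinuousMap.evalAlgHom ℝ ℝ t).toRingHom
  have hQ (X : Matrix ι ι ℝ) (t : T) :
      matEval (X * ρ t) p = Q.eval₂ (evalAt t) (fun ij => X ij.1 ij.2) := by
    have h := MvPolynomial.hom_eval₂ p (MvPolynomial.C.comp (algebraMap ℝ C(T, ℝ)))
      (MvPolynomial.eval₂Hom (evalAt t) fun ij : ι × ι => X ij.1 ij.2)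
      (fun ij => ∑ l, MvPolynomial.X (ij.1, l) *
        MvPolynomial.C (⟨fun t => ρ t l ij.2, hρ.matrix_elem l ij.2⟩ : C(T, ℝ)))
    rw [MvPolynomial.coe_eval₂Hom] at h
    rw [h, matEval, MvPolynomial.eval, MvPolynomial.coe_eval₂Hom]
    congr 1
    · ext r
      simp [evalAt]
    · funext ij
      simp [evalAt, Matrix.mul_apply]
  refine ⟨∑ m ∈ Q.support, MvPolynomial.monomial m (∫ t, Q.coeff m t ∂μ), fun X => ?_⟩
  simp_rw [hQ, MvPolynomial.eval₂_eq]
  rw [integral_finsetSum]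
  · simp only [matEval, map_sum, MvPolynomial.eval_monomial, Finsupp.prod]
    refine Finset.sum_congr rfl fun m _ => ?_
    rw [← integral_mul_const]
    rfl
  · intro m _
    exact Integrable.mul_const
      ((Q.coeff m).continuous.integrable_of_hasCompactSupport (.of_compactSpace _)) _

variable [DecidableEq ι]

instance : CompactSpace (Matrix.orthogonalGroup ι ℝ) := by
  have hclosed : IsClosed (Matrix.orthogonalGroup ι ℝ : Set (Matrix ι ι ℝ)) := isClosed_unitary
  refine isCompact_iff_compactSpace.mp (IsCompact.of_isClosed_subset (isCompact_univ_pi fun _ : ι => isCompact_univ_pi fun _ : ι =>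
    isCompact_Icc (a := (-1 : ℝ)) (b := 1)) hclosed ?_)
  intro U hU i _ j _
  exact abs_le.mp (entry_norm_bound_of_unitary hU i j)

/-- Polynomials in the matrix entries uniformly approximate continuous functions on the
orthogonal group. -/
lemma exists_matEval_near (f : C(Matrix.orthogonalGroup ι ℝ, ℝ)) {ε : ℝ} (hε : 0 < ε) :
    ∃ p : MvPolynomial (ι × ι) ℝ,
      ∀ U : Matrix.orthogonalGroup ι ℝ, |matEval U.1 p - f U| < ε := by
  let entry (ij : ι × ι) : C(Matrix.orthogonalGroup ι ℝ, ℝ) :=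
    ⟨fun U => U.1 ij.1 ij.2, continuous_subtype_val.matrix_elem _ _⟩
  have hsep : (MvPolynomial.aeval (R := ℝ) entry).range.SeparatesPoints := by
    intro U V hUV
    obtain ⟨i, j, hij⟩ : ∃ i j, U.1 i j ≠ V.1 i j := by
      by_contra! h
      exact hUV (Subtype.ext (Matrix.ext h))
    exact ⟨_, ⟨entry (i, j), ⟨MvPolynomial.X (i, j), MvPolynomial.aeval_X _ _⟩, rfl⟩, hij⟩
  obtain ⟨⟨g, p, rfl⟩, hp⟩ :=
    ContinuousMap.exists_mem_subalgebra_near_continuous_of_separatesPoints _ hsep f f.continuous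
      ε hε
  refine ⟨p, fun U => ?_⟩
  convert hp U
  have h := MvPolynomial.comp_aeval_apply (R := ℝ) (f := entry)
    (ContinuousMap.evalAlgHom ℝ ℝ U) p
  rw [Real.norm_eq_abs]
  refine congrArg (fun x => |x - f U|) ?_
  exact h.symm

/-- A closed subgroup of the orthogonal group is separated from the other orthogonal matrices by
polynomials. -/
lemma exists_matEval_ne_zero_of_notMem (K : Subgroup (Matrix.orthogonalGroup ι ℝ))
    (hK : IsClosed (K : Set (Matrix.orthogonalGroup ι ℝ))) {M : Matrix.orthogonalGroup ι ℝ}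
    (hM : M ∉ K) :
    ∃ p : MvPolynomial (ι × ι) ℝ, (∀ U ∈ K, matEval U.1 p = 0) ∧ matEval M.1 p ≠ 0 := by
  have : CompactSpace K := isCompact_iff_compactSpace.mp hK.isCompact
  let _ : MeasurableSpace K := borel K
  have : BorelSpace K := ⟨rfl⟩
  let μ : Measure K := Measure.haarMeasure ⊤
  have : IsProbabilityMeasure μ := ⟨Measure.haarMeasure_self⟩
  have hdisj : Disjoint (K : Set (Matrix.orthogonalGroup ι ℝ)) ((M⁻¹ * ·) ⁻¹' K) := by
    rw [Set.disjoint_left]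
    intro U hU hMU
    exact hM (inv_mem_iff.mp ((K.mul_mem_cancel_right hU).mp hMU))
  obtain ⟨f, hf0, hf1, -⟩ := exists_continuous_zero_one_of_isClosed hK
    (hK.preimage (continuous_const_mul M⁻¹)) hdisj
  obtain ⟨p, hp⟩ := exists_matEval_near f (ε := 1 / 3) (by norm_num)
  have hρ : Continuous fun k : K => k.1.1 := continuous_subtype_val.comp continuous_subtype_val
  obtain ⟨q, hq⟩ := exists_matEval_eq_integral μ (fun k : K => k.1.1) hρ p
  have hint (X : Matrix ι ι ℝ) : Integrable (fun k : K => matEval (X * k.1.1) p) μ :=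
    ((continuous_matEval p).comp (continuous_const.mul hρ)).integrable_of_hasCompactSupport
      (.of_compactSpace _)
  have hinv (U) (hU : U ∈ K) : matEval U.1 q = matEval 1 q := by
    rw [hq, hq]
    simpa using integral_mul_left_eq_self (μ := μ) (fun k : K => matEval k.1.1 p) ⟨U, hU⟩
  have hone : matEval 1 q ≤ 1 / 3 := by
    rw [hq]
    calc _ ≤ ∫ _ : K, (1 / 3 : ℝ) ∂μ := by
          refine integral_mono (hint 1) (integrable_const _) fun k => ?_
          have h := abs_lt.mp (hp k.1)
          rw [hf0 k.2] at h
          simp only [Pi.zero_apply] at h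
          simp only [one_mul]
          linarith
      _ = _ := by simp
  have hMq : 2 / 3 ≤ matEval M.1 q := by
    rw [hq]
    calc _ = ∫ _ : K, (2 / 3 : ℝ) ∂μ := by simp
      _ ≤ _ := by
          refine integral_mono (integrable_const _) (hint M.1) fun k => ?_
          have h := abs_lt.mp (hp (M * k.1))
          rw [hf1 (by simp)] at h
          simp only [Pi.one_apply] at h
          change _ ≤ matEval (M * k.1).1 p
          linarith
  have hsub (X : Matrix ι ι ℝ) :
      matEval X (q - MvPolynomial.C (matEval 1 q)) = matEval X q - matEval 1 q := by
    simp only [matEval, map_sub, MvPolynomial.eval_C]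
  refine ⟨q - MvPolynomial.C (matEval 1 q), fun U hU => ?_, ?_⟩
  · rw [hsub, hinv U hU, sub_self]
  · rw [hsub]
    linarith

/-- A matrix that is not orthogonal violates one of the polynomial equations that define the
orthogonal group. -/
lemma exists_matEval_ne_zero_of_notMem_orthogonalGroup {M : Matrix ι ι ℝ}
    (hM : M ∉ Matrix.orthogonalGroup ι ℝ) :
    ∃ p : MvPolynomial (ι × ι) ℝ,
      (∀ U ∈ Matrix.orthogonalGroup ι ℝ, matEval U p = 0) ∧ matEval M p ≠ 0 := by
  rw [Matrix.mem_orthogonalGroup_iff'] at hM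
  obtain ⟨i, j, hij⟩ : ∃ i j, (Mᵀ * M) i j ≠ (1 : Matrix ι ι ℝ) i j := by
    by_contra! h
    exact hM (Matrix.ext h)
  let p : MvPolynomial (ι × ι) ℝ :=
    ∑ l, MvPolynomial.X (l, i) * MvPolynomial.X (l, j) -
      MvPolynomial.C ((1 : Matrix ι ι ℝ) i j)
  have hp (X : Matrix ι ι ℝ) : matEval X p = (Xᵀ * X) i j - (1 : Matrix ι ι ℝ) i j := by
    simp [matEval, p, Matrix.mul_apply]
  refine ⟨p, fun U hU => ?_, ?_⟩
  · rw [hp, (Matrix.mem_orthogonalGroup_iff' _ _).mp hU, sub_self]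
  · rw [hp]
    exact sub_ne_zero.mpr hij

/-- The closure of a submonoid generated by orthogonal matrices is a closed subgroup of the
orthogonal group. -/
lemma exists_subgroup_closure_submonoidClosure {S : Set (Matrix ι ι ℝ)}
    (hS : S ⊆ Matrix.orthogonalGroup ι ℝ) :
    ∃ K : Subgroup (Matrix.orthogonalGroup ι ℝ),
      IsClosed (K : Set (Matrix.orthogonalGroup ι ℝ)) ∧
      closure (Submonoid.closure S : Set (Matrix ι ι ℝ)) = Subtype.val '' K.carrier := by
  let s : Set (Matrix.orthogonalGroup ι ℝ) := Subtype.val ⁻¹' S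
  refine ⟨(Subgroup.closure s).topologicalClosure, Subgroup.isClosed_topologicalClosure _, ?_⟩
  have hs : Subtype.val '' s = S := by
    exact (Subtype.image_preimage_coe _ _).trans (Set.inter_eq_right.mpr hS)
  have hmap : (Submonoid.closure S : Set (Matrix ι ι ℝ)) =
      Subtype.val '' (Submonoid.closure s : Set (Matrix.orthogonalGroup ι ℝ)) := by
    conv_lhs => rw [← hs]
    exact congrArg SetLike.coe
      (MonoidHom.map_mclosure (Matrix.orthogonalGroup ι ℝ).subtype s).symm
  have hemb : Topology.IsClosedEmbedding
      (Subtype.val : Matrix.orthogonalGroup ι ℝ → Matrix ι ι ℝ) :=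
    isClosed_unitary.isClosedEmbedding_subtypeVal
  rw [hmap, hemb.closure_image_eq, closure_submonoidClosure_eq_closure_subgroupClosure]
  rfl

end OrthogonalGroup

/-- For a monoid morphism `φ` from a free monoid into the orthogonal matrices and
any language `L`, the closure of the submonoid generated by `φ(L)` is an algebraic set: it is
the common zero set of some set of real polynomials in the matrix entries. -/
theorem closure_submonoid_image_isAlgebraic {m n : ℕ}
    (φ : FreeMonoid (Fin m) →* Matrix (Fin n) (Fin n) ℝ)
    (hφ : ∀ w, (φ w)ᵀ * φ w = 1) (L : Set (FreeMonoid (Fin m))) :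
    ∃ P : Set (MvPolynomial (Fin n × Fin n) ℝ),
      closure (Submonoid.closure (φ '' L) : Set (Matrix (Fin n) (Fin n) ℝ))
        = {M : Matrix (Fin n) (Fin n) ℝ | ∀ p ∈ P, matEval M p = 0} := by
  obtain ⟨K, hK, hKS⟩ := exists_subgroup_closure_submonoidClosure (S := φ '' L) (by
    rintro _ ⟨w, -, rfl⟩
    exact (Matrix.mem_orthogonalGroup_iff' _ _).mpr (hφ w))
  refine ⟨{p | ∀ U ∈ K, matEval U.1 p = 0}, hKS ▸ Set.Subset.antisymm ?_ fun M hM => ?_⟩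
  · rintro _ ⟨U, hU, rfl⟩ p hp
    exact hp U hU
  · have hMO : M ∈ Matrix.orthogonalGroup (Fin n) ℝ := by
      by_contra h
      obtain ⟨p, hp, hpM⟩ := exists_matEval_ne_zero_of_notMem_orthogonalGroup h
      exact hpM (hM p fun U _ => hp U U.2)
    refine ⟨⟨M, hMO⟩, ?_, rfl⟩
    by_contra h
    obtain ⟨p, hp, hpM⟩ := exists_matEval_ne_zero_of_notMem K hK h
    exact hpM (hM p hp)
end
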